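/- Let n ≥ 1 and suppose the N nonzero vectors 𝒞 = (C₁,…,C_N) in V satisfy the incidence conditions (I.1), (I.2), (I.3). Let γ : [0,1] → V be a continuous map with B(γ(t),γ(t)) < 0 for all t ∈ [0,1], and suppose the set of t ∈ [0,1] with γ(t) ∉ Reg(𝒞) is finite. Then t ↦ w(γ(t);𝒞) is constant on [0,1]. -/

import Mathlib

/-- The bilinear form of signature (n,2) on ℝ^(n+2): first two coordinates negative. -/
noncomputable def B (n : ℕ) (x y : Fin (n + 2) → ℝ) : ℝ :=
  ∑ i : Fin (n + 2), (if (i : ℕ) < 2 then -1 else 1) * (x i * y i)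

/-- w(x;𝒞) = ∑_j sgn(B(x,C_j)) sgn(B(x,C_{j+1})), with cyclic indexing. -/
noncomputable def wt (n N : ℕ) [NeZero N] (C : Fin N → (Fin (n + 2) → ℝ))
    (x : Fin (n + 2) → ℝ) : ℝ :=
  ∑ j : Fin N, Real.sign (B n x (C j)) * Real.sign (B n x (C (j + 1)))

/-- Incidence condition (I.1). -/
def I1 (n N : ℕ) (C : Fin N → (Fin (n + 2) → ℝ)) : Prop :=
  ∀ j, B n (C j) (C j) ≤ 0

/-- Incidence condition (I.2). -/
def I2 (n N : ℕ) [NeZero N] (C : Fin N → (Fin (n + 2) → ℝ)) : Prop :=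
  ∀ j : Fin N,
    (B n (C j) (C j) * B n (C (j + 1)) (C (j + 1)) > 0 →
      B n (C j) (C j) * B n (C (j + 1)) (C (j + 1)) - (B n (C j) (C (j + 1))) ^ 2 > 0) ∧
    (B n (C j) (C j) * B n (C (j + 1)) (C (j + 1)) = 0 →
      B n (C j) (C j) * B n (C (j + 1)) (C (j + 1)) - (B n (C j) (C (j + 1))) ^ 2 = 0)

/-- Incidence condition (I.3). -/
def I3 (n N : ℕ) [NeZero N] (C : Fin N → (Fin (n + 2) → ℝ)) : Prop :=
  ∀ j : Fin N,
    (B n (C j) (C j) < 0 →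
      B n (C j) (C j) * B n (C (j - 1)) (C (j + 1)) -
        B n (C j) (C (j - 1)) * B n (C j) (C (j + 1)) < 0) ∧
    (B n (C j) (C j) = 0 → B n (C (j - 1)) (C (j + 1)) > 0)

theorem B_comm {n : ℕ} (x y : Fin (n + 2) → ℝ) : B n x y = B n y x := by
  simp only [B, mul_comm (x _)]

theorem B_add_left {n : ℕ} (x y z : Fin (n + 2) → ℝ) : B n (x + y) z = B n x z + B n y z := by
  simp only [B, ← Finset.sum_add_distrib, Pi.add_apply]
  exact Finset.sum_congr rfl fun i _ => by ring

theorem B_smul_left {n : ℕ} (a : ℝ) (x z : Fin (n + 2) → ℝ) : B n (a • x) z = a * B n x z := by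
  simp only [B, Finset.mul_sum, Pi.smul_apply, smul_eq_mul]
  exact Finset.sum_congr rfl fun i _ => by ring

theorem B_add_right {n : ℕ} (x y z : Fin (n + 2) → ℝ) : B n z (x + y) = B n z x + B n z y := by
  rw [B_comm, B_add_left, B_comm x, B_comm y]

theorem B_smul_right {n : ℕ} (a : ℝ) (x z : Fin (n + 2) → ℝ) : B n z (a • x) = a * B n z x := by
  rw [B_comm, B_smul_left, B_comm x]

theorem continuous_B_left {n : ℕ} (c : Fin (n + 2) → ℝ) : Continuous fun x => B n x c := by
  unfold B
  fun_prop

/-- The form is positive definite on the vectors whose two negative coordinates vanish. -/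
theorem eq_zero_of_B_self_nonpos {n : ℕ} {w : Fin (n + 2) → ℝ} (h0 : w 0 = 0) (h1 : w 1 = 0)
    (hw : B n w w ≤ 0) : w = 0 := by
  have hsum : B n w w = ∑ i, w i * w i := by
    refine Finset.sum_congr rfl fun i _ => ?_
    split_ifs with hi
    · have : i = 0 ∨ i = 1 := by
        simp only [Fin.ext_iff, Fin.val_zero, Fin.val_one]
        omega
      rcases this with rfl | rfl <;> simp [h0, h1]
    · ring
  have hnonneg : ∀ i ∈ Finset.univ, 0 ≤ w i * w i := fun i _ => mul_self_nonneg _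
  have hzero := (Finset.sum_eq_zero_iff_of_nonneg hnonneg).1
    (le_antisymm (hsum ▸ hw) (Finset.sum_nonneg hnonneg))
  funext i
  exact mul_self_eq_zero.1 (hzero i (Finset.mem_univ i))

/-- The form is positive semidefinite on the orthogonal complement of a negative vector `x` and a
nonzero nonpositive vector `c` orthogonal to `x`. -/
theorem B_self_nonneg_of_orthogonal {n : ℕ} {x c v : Fin (n + 2) → ℝ} (hx : B n x x < 0)
    (hc : B n c c ≤ 0) (hc0 : c ≠ 0) (hxc : B n x c = 0) (hxv : B n x v = 0)
    (hcv : B n c v = 0) : 0 ≤ B n v v := by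
  by_contra! hv
  have hcx : B n c x = 0 := by rw [B_comm, hxc]
  have hvx : B n v x = 0 := by rw [B_comm, hxv]
  have hvc : B n v c = 0 := by rw [B_comm, hcv]
  have key : ∀ a b d : ℝ, a * x 0 + b * v 0 + d * c 0 = 0 → a * x 1 + b * v 1 + d * c 1 = 0 →
      a = 0 ∧ b = 0 ∧ d = 0 := by
    intro a b d h0 h1
    have hB : B n (a • x + b • v + d • c) (a • x + b • v + d • c)
        = a ^ 2 * B n x x + b ^ 2 * B n v v + d ^ 2 * B n c c := by
      simp only [B_add_left, B_add_right, B_smul_left, B_smul_right, hxc, hxv, hcv, hcx, hvx, hvc]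
      ring
    have ha2 := mul_nonneg (sq_nonneg a) (neg_nonneg.2 hx.le)
    have hb2 := mul_nonneg (sq_nonneg b) (neg_nonneg.2 hv.le)
    have hd2 := mul_nonneg (sq_nonneg d) (neg_nonneg.2 hc)
    have hw := eq_zero_of_B_self_nonpos (w := a • x + b • v + d • c) (by simpa using h0)
      (by simpa using h1) (by rw [hB]; linarith)
    have hz : a ^ 2 * B n x x + b ^ 2 * B n v v + d ^ 2 * B n c c = 0 := by
      rw [← hB, hw]
      simp [B]
    have ha : a = 0 := by
      have : a ^ 2 * B n x x = 0 := by linarith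
      simpa [hx.ne] using this
    have hb : b = 0 := by
      have : b ^ 2 * B n v v = 0 := by linarith
      simpa [hv.ne] using this
    refine ⟨ha, hb, ?_⟩
    simpa [ha, hb, hc0] using hw
  obtain ⟨-, -, hd⟩ := key (v 0 * c 1 - v 1 * c 0) (c 0 * x 1 - c 1 * x 0)
    (x 0 * v 1 - x 1 * v 0) (by ring) (by ring)
  obtain ⟨-, hx0, -⟩ := key (-v 0) (x 0) 0 (by ring) (by linarith)
  obtain ⟨-, hx1, -⟩ := key (-v 1) (x 1) 0 (by linarith) (by ring)
  exact one_ne_zero (key 1 0 0 (by simp [hx0]) (by simp [hx1])).1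

/-- Nonpositive vectors `y`, `z` orthogonal to `c` with `B y z > 0` lie in opposite cones of the
complement of `c`, so a negative vector of that complement pairs with them with opposite signs. -/
theorem B_mul_B_neg_of_orthogonal {n : ℕ} {x c y z : Fin (n + 2) → ℝ} (hx : B n x x < 0)
    (hc : B n c c ≤ 0) (hc0 : c ≠ 0) (hxc : B n x c = 0) (hcy : B n c y = 0) (hcz : B n c z = 0)
    (hy : B n y y ≤ 0) (hz : B n z z ≤ 0) (hyz : 0 < B n y z) :
    B n x y * B n x z < 0 := by
  have hcx : B n c x = 0 := by rw [B_comm, hxc]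
  have ne_zero : ∀ {u v : Fin (n + 2) → ℝ}, B n c u = 0 → B n c v = 0 → B n u u ≤ 0 →
      0 < B n u v → B n x u ≠ 0 := by
    intro u v hcu hcv hu huv hxu
    have hux : B n u x = 0 := by rw [B_comm, hxu]
    have hvu : B n v u = B n u v := B_comm v u
    have hvx : B n v x = B n x v := B_comm v x
    have h : ∀ s : ℝ, 0 ≤ B n x x * (B n x x * B n v v - B n x v ^ 2 + 2 * s * B n u v) := by
      intro s
      have hs := B_self_nonneg_of_orthogonal (v := s • u + B n x x • v + (-B n x v) • x)
        hx hc hc0 hxc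
        (by simp only [B_add_right, B_smul_right, hxu]; ring)
        (by simp only [B_add_right, B_smul_right, hcu, hcv, hcx]; ring)
      simp only [B_add_left, B_add_right, B_smul_left, B_smul_right, hxu, hux, hvu, hvx] at hs
      nlinarith [mul_nonneg (sq_nonneg s) (neg_nonneg.2 hu)]
    have hs := h ((1 - (B n x x * B n v v - B n x v ^ 2)) / (2 * B n u v))
    have hcancel : 2 * ((1 - (B n x x * B n v v - B n x v ^ 2)) / (2 * B n u v)) * B n u v
        = 1 - (B n x x * B n v v - B n x v ^ 2) := by
      field_simp
    rw [hcancel] at hs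
    linarith
  have hv := B_self_nonneg_of_orthogonal (v := B n x z • y + (-B n x y) • z) hx hc hc0 hxc
    (by simp only [B_add_right, B_smul_right]; ring)
    (by simp only [B_add_right, B_smul_right, hcy, hcz]; ring)
  have hzy : B n z y = B n y z := B_comm z y
  simp only [B_add_left, B_add_right, B_smul_left, B_smul_right, hzy] at hv
  have hle : B n x y * B n x z * B n y z ≤ 0 := by
    nlinarith [mul_nonneg (sq_nonneg (B n x z)) (neg_nonneg.2 hy),
      mul_nonneg (sq_nonneg (B n x y)) (neg_nonneg.2 hz)]
  exact lt_of_le_of_ne (nonpos_of_mul_nonpos_left hle hyz)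
    (mul_ne_zero (ne_zero hcy hcz hy hyz) (ne_zero hcz hcy hz (hzy ▸ hyz)))

/-- If `B x (C j) = 0` for a negative vector `x`, then `x` pairs with the two neighbours of `C j`
with opposite signs. -/
theorem B_mul_B_neg_of_incidence {n : ℕ} {N : ℕ} [NeZero N] {C : Fin N → (Fin (n + 2) → ℝ)}
    (hC : ∀ j, C j ≠ 0) (h1 : I1 n N C) (h2 : I2 n N C) (h3 : I3 n N C)
    {x : Fin (n + 2) → ℝ} (hx : B n x x < 0) {j : Fin N} (hj : B n x (C j) = 0) :
    B n x (C (j - 1)) * B n x (C (j + 1)) < 0 := by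
  have adj : ∀ k, B n (C k) (C (k + 1)) ^ 2 ≤ B n (C k) (C k) * B n (C (k + 1)) (C (k + 1)) := by
    intro k
    rcases (mul_nonneg_of_nonpos_of_nonpos (h1 k) (h1 (k + 1))).lt_or_eq with h | h
    · linarith [(h2 k).1 h]
    · linarith [(h2 k).2 h.symm]
  have hprev := adj (j - 1)
  rw [sub_add_cancel, B_comm, mul_comm] at hprev
  have hnext := adj j
  have hyc := B_comm (C (j - 1)) (C j)
  have hzc := B_comm (C (j + 1)) (C j)
  have hy := h1 (j - 1)
  have hz := h1 (j + 1)
  rcases (h1 j).lt_or_eq with hc | hc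
  · have hyz := (h3 j).1 hc
    have h := B_mul_B_neg_of_orthogonal
      (y := B n (C j) (C j) • C (j - 1) + (-B n (C j) (C (j - 1))) • C j)
      (z := B n (C j) (C j) • C (j + 1) + (-B n (C j) (C (j + 1))) • C j)
      hx hc.le (hC j) hj
      (by simp only [B_add_right, B_smul_right]; ring)
      (by simp only [B_add_right, B_smul_right]; ring)
      (by
        simp only [B_add_left, B_add_right, B_smul_left, B_smul_right, hyc]
        linarith [mul_nonpos_of_nonpos_of_nonneg hc.le (sub_nonneg.2 hprev)])
      (by
        simp only [B_add_left, B_add_right, B_smul_left, B_smul_right, hzc]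
        linarith [mul_nonpos_of_nonpos_of_nonneg hc.le (sub_nonneg.2 hnext)])
      (by
        simp only [B_add_left, B_add_right, B_smul_left, B_smul_right, hyc]
        linarith [mul_pos_of_neg_of_neg hc hyz])
    simp only [B_add_right, B_smul_right, hj, mul_zero, add_zero] at h
    refine neg_of_mul_neg_right (a := B n (C j) (C j) ^ 2) ?_ (sq_nonneg _)
    linarith
  · rw [hc, zero_mul] at hprev hnext
    exact B_mul_B_neg_of_orthogonal hx hc.le (hC j) hj (by nlinarith) (by nlinarith) hy hz
      ((h3 j).2 hc)

/-- A cyclic sum of products of neighbours does not change when zero entries are modified, provided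
the two neighbours of each zero entry are nonzero and opposite. -/
theorem sum_mul_succ_eq {N : ℕ} [NeZero N] {s s' : Fin N → ℝ}
    (hs : ∀ j, s j ≠ 0 → s' j = s j)
    (hz : ∀ j, s j = 0 → s (j + 1) ≠ 0 ∧ s (j - 1) + s (j + 1) = 0) :
    ∑ j, s' j * s' (j + 1) = ∑ j, s j * s (j + 1) := by
  have hshift : ∑ j, s j * (s' (j + 1) - s (j + 1)) = ∑ j, s (j - 1) * (s' j - s j) := by
    rw [← Equiv.sum_comp (Equiv.addRight (1 : Fin N)) fun j => s (j - 1) * (s' j - s j)]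
    simp
  have hdiff : ∀ j, s' j * s' (j + 1) - s j * s (j + 1) - s j * (s' (j + 1) - s (j + 1))
      = -(s (j - 1) * (s' j - s j)) := by
    intro j
    by_cases h : s j = 0
    · obtain ⟨hne, hadd⟩ := hz j h
      rw [hs _ hne, h]
      linear_combination s' j * hadd
    · rw [hs j h]
      ring
  have := Finset.sum_congr (rfl : Finset.univ = Finset.univ) fun j _ => hdiff j
  simp only [Finset.sum_sub_distrib, Finset.sum_neg_distrib] at this hshift
  linarith

theorem sign_add_sign_eq_zero {a b : ℝ} (h : a * b < 0) : Real.sign a + Real.sign b = 0 := by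
  rcases mul_neg_iff.1 h with ⟨ha, hb⟩ | ⟨ha, hb⟩ <;>
    simp [Real.sign_of_pos, Real.sign_of_neg, ha, hb]

/-- The real sign function is locally constant away from zero. -/
theorem eventually_sign_eq {a : ℝ} (ha : a ≠ 0) : ∀ᶠ b in nhds a, Real.sign b = Real.sign a := by
  rcases ha.lt_or_gt with h | h
  · filter_upwards [gt_mem_nhds h] with b hb
    rw [Real.sign_of_neg hb, Real.sign_of_neg h]
  · filter_upwards [lt_mem_nhds h] with b hb
    rw [Real.sign_of_pos hb, Real.sign_of_pos h]

/-- Near a negative vector, `wt` is constant. -/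
theorem eventually_wt_eq {n : ℕ} {N : ℕ} [NeZero N] {C : Fin N → (Fin (n + 2) → ℝ)}
    (hC : ∀ j, C j ≠ 0) (h1 : I1 n N C) (h2 : I2 n N C) (h3 : I3 n N C)
    {x : Fin (n + 2) → ℝ} (hx : B n x x < 0) : ∀ᶠ y in nhds x, wt n N C y = wt n N C x := by
  have hsign : ∀ᶠ y in nhds x, ∀ j, B n x (C j) ≠ 0 →
      Real.sign (B n y (C j)) = Real.sign (B n x (C j)) := by
    refine Filter.eventually_all.2 fun j => ?_
    by_cases h : B n x (C j) = 0
    · simp [h]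
    · filter_upwards [(continuous_B_left (C j)).continuousAt.eventually (eventually_sign_eq h)]
        with y hy _ using hy
  filter_upwards [hsign] with y hy
  refine sum_mul_succ_eq (s := fun j => Real.sign (B n x (C j)))
    (s' := fun j => Real.sign (B n y (C j))) (fun j hj => hy j ?_) fun j hj => ?_
  · simpa [Real.sign_eq_zero_iff] using hj
  · have hneg := B_mul_B_neg_of_incidence hC h1 h2 h3 hx (Real.sign_eq_zero_iff.1 hj)
    exact ⟨fun h => by simp [Real.sign_eq_zero_iff.1 h] at hneg, sign_add_sign_eq_zero hneg⟩

/-- under (I.1)-(I.3), w(γ(t);𝒞) is constant along a continuous path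
of negative vectors meeting the non-regular locus in finitely many times. -/
theorem w_constant_along_path (n N : ℕ) (hn : 1 ≤ n) [NeZero N]
    (C : Fin N → (Fin (n + 2) → ℝ)) (hC : ∀ j, C j ≠ 0)
    (h1 : I1 n N C) (h2 : I2 n N C) (h3 : I3 n N C)
    (γ : ℝ → (Fin (n + 2) → ℝ)) (hcont : ContinuousOn γ (Set.Icc 0 1))
    (hneg : ∀ t ∈ Set.Icc (0 : ℝ) 1, B n (γ t) (γ t) < 0)
    (hfin : {t ∈ Set.Icc (0 : ℝ) 1 | ∃ j, B n (γ t) (C j) = 0}.Finite) :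
    ∀ t ∈ Set.Icc (0 : ℝ) 1, wt n N C (γ t) = wt n N C (γ 0) := by
  have hlc : IsLocallyConstant fun t : Set.Icc (0 : ℝ) 1 => wt n N C (γ t) :=
    (IsLocallyConstant.iff_eventually_eq _).2 fun t =>
      (continuousOn_iff_continuous_domRestrict.1 hcont).continuousAt.eventually
        (eventually_wt_eq hC h1 h2 h3 (hneg t t.2))
  exact fun t ht => hlc.apply_eq_of_preconnectedSpace ⟨t, ht⟩ ⟨0, by simp⟩
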